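/- arXiv:1004.0732 — 3 statements merged into one kernel-verified Lean document; each statement's English description precedes it below -/
import Mathlib

section
/- Let V be a finite-dimensional complex vector space and B : V × V → ℂ a symmetric bilinear form with radical R = {v ∈ V | B(v,w) = 0 for all w ∈ V}. Suppose V is the internal direct sum of two subspaces W₁ and W₂, each of which is totally isotropic for B (i.e. B vanishes identically on W₁ × W₁ and on W₂ × W₂). Then dim W₁ − dim (W₁ ⊓ R) = dim W₂ − dim (W₂ ⊓ R); in particular, if B is nondegenerate, then dim W₁ = dim W₂ and dim V = 2·dim W₁. -/
open Module in
/-- A bilinear pairing of finite-dimensional spaces and its flip have the same rank. -/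
theorem LinearMap.finrank_range_flip_eq {K M N : Type*} [Field K]
    [AddCommGroup M] [Module K M] [FiniteDimensional K M]
    [AddCommGroup N] [Module K N] [FiniteDimensional K N] (f : M →ₗ[K] N →ₗ[K] K) :
    finrank K (LinearMap.range f.flip) = finrank K (LinearMap.range f) := by
  have h : f.flip = f.dualMap ∘ₗ (evalEquiv K N).toLinearMap := by
    ext; simp
  rw [h, LinearMap.range_comp_of_range_eq_top _ (LinearEquiv.range _),
    LinearMap.finrank_range_dualMap_eq_finrank_range]

/-- If `W₁` is totally isotropic and `W₁ ⊔ W₂ = ⊤`, the left kernel of the pairing of `W₁` with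
`W₂` is the intersection of `W₁` with the radical. -/
theorem LinearMap.ker_domRestrict₁₂_of_isotropic {K V : Type*} [Field K]
    [AddCommGroup V] [Module K V] (B : V →ₗ[K] V →ₗ[K] K) (W₁ W₂ : Submodule K V)
    (hsup : W₁ ⊔ W₂ = ⊤) (h₁ : ∀ w ∈ W₁, ∀ w' ∈ W₁, B w w' = 0) :
    LinearMap.ker (B.domRestrict₁₂ W₁ W₂) = (LinearMap.ker B).comap W₁.subtype := by
  ext x
  simp only [LinearMap.mem_ker, Submodule.mem_comap, Submodule.subtype_apply]
  refine ⟨fun h => LinearMap.ext fun v => ?_, fun h => LinearMap.ext fun y => ?_⟩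
  · obtain ⟨a, ha, b, hb, rfl⟩ := Submodule.mem_sup.1 (hsup ▸ Submodule.mem_top : v ∈ W₁ ⊔ W₂)
    have hxb : B x b = 0 := LinearMap.congr_fun h ⟨b, hb⟩
    simp [h₁ x x.2 a ha, hxb]
  · exact LinearMap.congr_fun h y.1

open Module in
/-- The rank of the pairing of a totally isotropic `W₁` with a supplement `W₂`. -/
theorem LinearMap.finrank_range_domRestrict₁₂_add_of_isotropic {K V : Type*} [Field K]
    [AddCommGroup V] [Module K V] [FiniteDimensional K V] (B : V →ₗ[K] V →ₗ[K] K)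
    (W₁ W₂ : Submodule K V) (hsup : W₁ ⊔ W₂ = ⊤) (h₁ : ∀ w ∈ W₁, ∀ w' ∈ W₁, B w w' = 0) :
    finrank K (LinearMap.range (B.domRestrict₁₂ W₁ W₂)) +
      finrank K ↥(W₁ ⊓ LinearMap.ker B) = finrank K W₁ := by
  rw [← LinearMap.finrank_range_add_finrank_ker (B.domRestrict₁₂ W₁ W₂),
    B.ker_domRestrict₁₂_of_isotropic W₁ W₂ hsup h₁, ← Submodule.map_comap_subtype,
    Submodule.finrank_map_subtype_eq]


/-- Let `V` be a finite-dimensional complex vector space and `B` a symmetric bilinear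
form on `V` with radical `R = ker B = {v | ∀ w, B v w = 0}`.  If `V` is the internal
direct sum of two totally isotropic subspaces `W₁` and `W₂`, then
`dim W₁ − dim (W₁ ⊓ R) = dim W₂ − dim (W₂ ⊓ R)`; in particular, if `B` is
nondegenerate, then `dim W₁ = dim W₂` and `dim V = 2 · dim W₁`. -/
theorem totallyIsotropic_complement_dim
    (V : Type*) [AddCommGroup V] [Module ℂ V] [FiniteDimensional ℂ V]
    (B : V →ₗ[ℂ] V →ₗ[ℂ] ℂ) (hsymm : ∀ v w : V, B v w = B w v)
    (W₁ W₂ : Submodule ℂ V) (hdisj : W₁ ⊓ W₂ = ⊥) (hsup : W₁ ⊔ W₂ = ⊤)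
    (h₁ : ∀ w ∈ W₁, ∀ w' ∈ W₁, B w w' = 0)
    (h₂ : ∀ w ∈ W₂, ∀ w' ∈ W₂, B w w' = 0) :
    Module.finrank ℂ ↥W₁ - Module.finrank ℂ ↥(W₁ ⊓ LinearMap.ker B)
      = Module.finrank ℂ ↥W₂ - Module.finrank ℂ ↥(W₂ ⊓ LinearMap.ker B) ∧
    (LinearMap.ker B = ⊥ →
      Module.finrank ℂ ↥W₁ = Module.finrank ℂ ↥W₂ ∧
      Module.finrank ℂ V = 2 * Module.finrank ℂ ↥W₁) := by
  have e₁ := B.finrank_range_domRestrict₁₂_add_of_isotropic W₁ W₂ hsup h₁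
  have e₂ := B.finrank_range_domRestrict₁₂_add_of_isotropic W₂ W₁ (sup_comm W₁ W₂ ▸ hsup) h₂
  have hflip : B.domRestrict₁₂ W₂ W₁ = (B.domRestrict₁₂ W₁ W₂).flip :=
    LinearMap.ext₂ fun x y => hsymm x y
  rw [hflip, LinearMap.finrank_range_flip_eq] at e₂
  refine ⟨by omega, fun hker => ?_⟩
  rw [hker, inf_bot_eq, finrank_bot] at e₁ e₂
  have hdim := Submodule.finrank_sup_add_finrank_inf_eq W₁ W₂
  rw [hsup, hdisj, finrank_top, finrank_bot] at hdim
  omega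
end

section
/- Fix an integer q ≥ 1. For a polynomial p ∈ ℂ[X,Y] the following are equivalent: (i) for every j with 1 ≤ j ≤ q, the monomial Y^j divides the j-th partial derivative ∂^j p/∂X^j in ℂ[X,Y]; (ii) p lies in the ℂ-linear span of the monomials X^k Y^ℓ with k, ℓ ∈ ℕ and ℓ ≥ min(k, q). -/
open MvPolynomial

namespace MvPolynomial

variable {σ R : Type*} [CommSemiring R]

theorem coeff_iterate_pderiv (i : σ) (p : MvPolynomial σ R) (j : ℕ) (m : σ →₀ ℕ) :
    coeff m ((⇑(pderiv (R := R) i))^[j] p) =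
      coeff (m + Finsupp.single i j) p * ((m i + 1).ascFactorial j : R) := by
  induction j generalizing m with
  | zero => simp
  | succ j ih =>
    rw [Function.iterate_succ_apply', coeff_pderiv, ih, add_assoc, ← Finsupp.single_add,
      add_comm 1 j, mul_assoc]
    have h : (m i + 1).ascFactorial (j + 1) = (m i + 1 + 1).ascFactorial j * (m i + 1) := by
      rw [mul_comm, Nat.succ_ascFactorial, Nat.ascFactorial_succ]
    simp [h]

theorem X_pow_dvd_iff_coeff_eq_zero {R : Type*} [CommRing R]
    (i : σ) (n : ℕ) (p : MvPolynomial σ R) :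
    X i ^ n ∣ p ↔ ∀ m : σ →₀ ℕ, m i < n → coeff m p = 0 := by
  classical
  rw [X_pow_eq_monomial, monomial_one_dvd_iff_modMonomial_eq_zero, MvPolynomial.ext_iff]
  refine forall_congr' fun m => ?_
  by_cases h : n ≤ m i
  · rw [coeff_modMonomial_of_le _ (Finsupp.single_le_iff.2 h)]
    simp [h.not_gt]
  · rw [coeff_modMonomial_of_not_le _ (mt Finsupp.single_le_iff.1 h)]
    simp [not_le.1 h]

end MvPolynomial

/-- Fix an integer `q ≥ 1`.  For `p ∈ ℂ[X,Y]` the following are equivalent: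
(i) for every `1 ≤ j ≤ q`, the monomial `Y^j` divides the `j`-th partial derivative
`∂^j p / ∂X^j`; (ii) `p` lies in the `ℂ`-linear span of the monomials `X^k * Y^ℓ`
with `ℓ ≥ min k q`. -/
theorem mem_span_monomials_iff_pow_dvd_iterated_pderiv
    (q : ℕ) (hq : 1 ≤ q) (p : MvPolynomial (Fin 2) ℂ) :
    (∀ j : ℕ, 1 ≤ j → j ≤ q →
        (X 1 : MvPolynomial (Fin 2) ℂ) ^ j ∣ (⇑(pderiv (R := ℂ) (0 : Fin 2)))^[j] p) ↔
      p ∈ Submodule.span ℂ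
        {r : MvPolynomial (Fin 2) ℂ |
          ∃ k ℓ : ℕ, min k q ≤ ℓ ∧ r = X 0 ^ k * X 1 ^ ℓ} := by
  have hspan : {r : MvPolynomial (Fin 2) ℂ |
      ∃ k ℓ : ℕ, min k q ≤ ℓ ∧ r = X 0 ^ k * X 1 ^ ℓ} =
      (fun m => monomial m 1) '' {m : Fin 2 →₀ ℕ | min (m 0) q ≤ m 1} := by
    have key (m : Fin 2 →₀ ℕ) :
        (X 0 ^ m 0 * X 1 ^ m 1 : MvPolynomial (Fin 2) ℂ) = monomial m 1 := by
      simp [monomial_eq, Finsupp.prod_fintype]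
    ext r
    constructor
    · rintro ⟨k, ℓ, h, rfl⟩
      refine ⟨Finsupp.single 0 k + Finsupp.single 1 ℓ, by simpa using h, ?_⟩
      simp [← key]
    · rintro ⟨m, h, rfl⟩
      exact ⟨m 0, m 1, h, (key m).symm⟩
  rw [hspan, ← restrictSupport_eq_span, mem_restrictSupport_iff]
  simp_rw [X_pow_dvd_iff_coeff_eq_zero, coeff_iterate_pderiv]
  constructor
  · intro h m hm
    by_contra hlt
    have hlt : m 1 < min (m 0) q := not_le.1 hlt
    have hle : Finsupp.single 0 (min (m 0) q) ≤ m :=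
      Finsupp.single_le_iff.2 (min_le_left _ _)
    have := h (min (m 0) q) (by omega) (min_le_right _ _)
      (m - Finsupp.single 0 (min (m 0) q)) (by simpa using hlt)
    rw [tsub_add_cancel_of_le hle, mul_eq_zero, Nat.cast_eq_zero] at this
    exact this.elim (mem_support_iff.1 hm) (Nat.ascFactorial_pos _ _).ne'
  · intro h j _ hjq m hm
    rw [mul_eq_zero]
    left
    by_contra hc
    have : min (m 0 + j) q ≤ m 1 := by simpa using h (mem_support_iff.2 hc)
    omega
end

section
/- Let q ≥ 1 be an integer, regarded as an element of ℂ. In the polynomial ring ℂ[X], let J be the ℂ-subalgebra generated by the two polynomials X² − q² and (X − q)·(X² − q²)^q. Then for every natural number n there exists a nonzero f ∈ J with deg f = n if and only if n is even or n ≥ 2q + 1. Consequently, the associated graded of J with respect to the filtration of ℂ[X] by degree (the span of the leading terms of the nonzero elements of J) is exactly the ℂ-subalgebra of ℂ[X] generated by X² and X^{2q+1}. -/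
open Polynomial

theorem natDegree_X_sq_sub_C (c : ℂ) : (X ^ 2 - C c).natDegree = 2 :=
  natDegree_X_pow_sub_C

theorem monic_X_sq_sub_C (c : ℂ) : (X ^ 2 - C c).Monic :=
  monic_X_pow_sub_C c two_ne_zero

theorem monic_shifted_generator (a c : ℂ) (q : ℕ) :
    ((X - C a) * (X ^ 2 - C c) ^ q).Monic :=
  (monic_X_sub_C a).mul ((monic_X_sq_sub_C c).pow q)

theorem natDegree_shifted_generator (a c : ℂ) (q : ℕ) :
    ((X - C a) * (X ^ 2 - C c) ^ q).natDegree = 2 * q + 1 := by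
  rw [(monic_X_sub_C a).natDegree_mul ((monic_X_sq_sub_C c).pow q),
    (monic_X_sq_sub_C c).natDegree_pow, natDegree_X_sq_sub_C, natDegree_X_sub_C]
  ring

/-- The algebra generated by `u = X² - a²` and `v = (X - a) u ^ q` is `ℂ[u] + ℂ[u] v`, because
`v² = u ^ (2q + 1) - 2 a u ^ q v`. -/
theorem exists_comp_add_comp_mul_of_mem_adjoin (a : ℂ) (q : ℕ) {f : ℂ[X]}
    (hf : f ∈ Algebra.adjoin ℂ
      ({X ^ 2 - C (a ^ 2), (X - C a) * (X ^ 2 - C (a ^ 2)) ^ q} : Set ℂ[X])) :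
    ∃ P Q : ℂ[X], f = P.comp (X ^ 2 - C (a ^ 2)) +
      Q.comp (X ^ 2 - C (a ^ 2)) * ((X - C a) * (X ^ 2 - C (a ^ 2)) ^ q) := by
  induction hf using Algebra.adjoin_induction with
  | mem x hx =>
    rcases hx with rfl | rfl
    · exact ⟨X, 0, by simp⟩
    · exact ⟨0, 1, by simp⟩
  | algebraMap r => exact ⟨C r, 0, by simp⟩
  | add x y _ _ hx hy =>
    obtain ⟨P, Q, rfl⟩ := hx
    obtain ⟨P', Q', rfl⟩ := hy
    exact ⟨P + P', Q + Q', by simp only [add_comp]; ring⟩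
  | mul x y _ _ hx hy =>
    obtain ⟨P, Q, rfl⟩ := hx
    obtain ⟨P', Q', rfl⟩ := hy
    refine ⟨P * P' + Q * Q' * X ^ (2 * q + 1),
      P * Q' + Q * P' - C (2 * a) * (Q * Q' * X ^ q), ?_⟩
    simp only [add_comp, sub_comp, mul_comp, pow_comp, X_comp, C_comp, ofNat_comp, C_mul, C_pow,
      C_ofNat]
    ring

theorem even_or_le_natDegree_of_mem_adjoin (a : ℂ) (q : ℕ) {f : ℂ[X]}
    (hf : f ∈ Algebra.adjoin ℂ
      ({X ^ 2 - C (a ^ 2), (X - C a) * (X ^ 2 - C (a ^ 2)) ^ q} : Set ℂ[X])) :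
    Even f.natDegree ∨ 2 * q + 1 ≤ f.natDegree := by
  obtain ⟨P, Q, rfl⟩ := exists_comp_add_comp_mul_of_mem_adjoin a q hf
  have hP : (P.comp (X ^ 2 - C (a ^ 2))).natDegree = P.natDegree * 2 := by
    rw [natDegree_comp, natDegree_X_sq_sub_C]
  by_cases hQ : Q = 0
  · left
    simp only [hQ, zero_comp, zero_mul, add_zero, hP]
    exact even_two.mul_left _
  right
  have hQ' : Q.comp (X ^ 2 - C (a ^ 2)) ≠ 0 := by
    rw [Ne, comp_eq_zero_iff]
    rintro (h | ⟨-, h⟩)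
    · exact hQ h
    · have := congrArg natDegree h
      rw [natDegree_X_sq_sub_C, natDegree_C] at this
      omega
  have hQv : (Q.comp (X ^ 2 - C (a ^ 2)) *
      ((X - C a) * (X ^ 2 - C (a ^ 2)) ^ q)).natDegree = Q.natDegree * 2 + (2 * q + 1) := by
    rw [natDegree_mul hQ' (monic_shifted_generator _ _ _).ne_zero, natDegree_shifted_generator,
      natDegree_comp, natDegree_X_sq_sub_C]
  rcases lt_or_gt_of_ne (show P.natDegree * 2 ≠ Q.natDegree * 2 + (2 * q + 1) by omega) with h | h
  · rw [natDegree_add_eq_right_of_natDegree_lt (by omega), hQv]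
    omega
  · rw [natDegree_add_eq_left_of_natDegree_lt (by omega), hP]
    omega

theorem exists_mem_adjoin_natDegree_eq (a c : ℂ) (q : ℕ) {n : ℕ}
    (hn : Even n ∨ 2 * q + 1 ≤ n) :
    ∃ f ∈ Algebra.adjoin ℂ ({X ^ 2 - C c, (X - C a) * (X ^ 2 - C c) ^ q} : Set ℂ[X]),
      f ≠ 0 ∧ f.natDegree = n := by
  have hu (k : ℕ) : (X ^ 2 - C c) ^ k ∈
      Algebra.adjoin ℂ ({X ^ 2 - C c, (X - C a) * (X ^ 2 - C c) ^ q} : Set ℂ[X]) :=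
    pow_mem (Algebra.subset_adjoin (Set.mem_insert _ _)) k
  rcases Nat.even_or_odd' n with ⟨k, rfl | rfl⟩
  · refine ⟨_, hu k, ((monic_X_sq_sub_C c).pow k).ne_zero, ?_⟩
    rw [natDegree_pow, natDegree_X_sq_sub_C, mul_comm]
  · have hk : q ≤ k := by
      rcases hn with ⟨m, hm⟩ | hn <;> omega
    refine ⟨_, mul_mem (hu (k - q)) (Algebra.subset_adjoin (Set.mem_insert_of_mem _ rfl)),
      (((monic_X_sq_sub_C c).pow _).mul (monic_shifted_generator a c q)).ne_zero, ?_⟩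
    rw [((monic_X_sq_sub_C c).pow _).natDegree_mul (monic_shifted_generator a c q),
      natDegree_shifted_generator, natDegree_pow, natDegree_X_sq_sub_C]
    omega

/-- `ℂ[X², X ^ (2q + 1)]` is spanned by the monomials whose exponent is even or at least
`2q + 1`. -/
theorem span_X_pow_eq_adjoin (q : ℕ) :
    Submodule.span ℂ {g : ℂ[X] | ∃ n : ℕ, (Even n ∨ 2 * q + 1 ≤ n) ∧ g = X ^ n} =
      Subalgebra.toSubmodule (Algebra.adjoin ℂ ({X ^ 2, X ^ (2 * q + 1)} : Set ℂ[X])) := by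
  apply le_antisymm
  · rw [Submodule.span_le]
    rintro _ ⟨n, hn, rfl⟩
    have hX (k : ℕ) : (X : ℂ[X]) ^ (2 * k) ∈
        Algebra.adjoin ℂ ({X ^ 2, X ^ (2 * q + 1)} : Set ℂ[X]) := by
      rw [pow_mul]
      exact pow_mem (Algebra.subset_adjoin (Set.mem_insert _ _)) k
    rcases Nat.even_or_odd' n with ⟨k, rfl | rfl⟩
    · exact hX k
    · have hk : q ≤ k := by
        rcases hn with ⟨m, hm⟩ | hn <;> omega
      rw [show 2 * k + 1 = 2 * (k - q) + (2 * q + 1) by omega, pow_add X (2 * (k - q))]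
      exact Subalgebra.mul_mem _ (hX _) (Algebra.subset_adjoin (Set.mem_insert_of_mem _ rfl))
  · rw [Algebra.adjoin_eq_span]
    refine Submodule.span_mono fun x hx => ?_
    induction hx using Submonoid.closure_induction with
    | mem x hx =>
      rcases hx with rfl | rfl
      · exact ⟨2, Or.inl even_two, rfl⟩
      · exact ⟨2 * q + 1, Or.inr le_rfl, rfl⟩
    | one => exact ⟨0, Or.inl Even.zero, (pow_zero X).symm⟩
    | mul x y _ _ hx hy =>
      obtain ⟨m, hm, rfl⟩ := hx
      obtain ⟨n, hn, rfl⟩ := hy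
      refine ⟨m + n, ?_, (pow_add X m n).symm⟩
      rcases hm with hm | hm
      · rcases hn with hn | hn
        · exact Or.inl (hm.add hn)
        · exact Or.inr (by omega)
      · exact Or.inr (by omega)

/-- Let `q ≥ 1` be an integer, regarded as an element of `ℂ`, and let
`J = ℂ[X² − q², (X − q)(X² − q²)^q] ⊆ ℂ[X]`.  Then for every `n : ℕ` there is a
nonzero element of `J` of degree `n` iff `n` is even or `n ≥ 2q + 1`; consequently
the span of the leading monomials `X^(deg f)` over the nonzero `f ∈ J` (the
associated graded of `J` for the degree filtration) is exactly the subalgebra of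
`ℂ[X]` generated by `X²` and `X^(2q+1)`. -/
theorem gr_of_adjoin_shifted_generators (q : ℕ) (hq : 1 ≤ q) :
    (∀ n : ℕ,
      (∃ f ∈ Algebra.adjoin ℂ
            ({X ^ 2 - C ((q : ℂ) ^ 2),
              (X - C (q : ℂ)) * (X ^ 2 - C ((q : ℂ) ^ 2)) ^ q} : Set (Polynomial ℂ)),
          f ≠ 0 ∧ f.natDegree = n) ↔ (Even n ∨ 2 * q + 1 ≤ n)) ∧
    Submodule.span ℂ
        {g : Polynomial ℂ |
          ∃ f ∈ Algebra.adjoin ℂ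
              ({X ^ 2 - C ((q : ℂ) ^ 2),
                (X - C (q : ℂ)) * (X ^ 2 - C ((q : ℂ) ^ 2)) ^ q} : Set (Polynomial ℂ)),
            f ≠ 0 ∧ g = X ^ f.natDegree}
      = Subalgebra.toSubmodule
          (Algebra.adjoin ℂ ({X ^ 2, X ^ (2 * q + 1)} : Set (Polynomial ℂ))) := by
  have hdeg (n : ℕ) :
      (∃ f ∈ Algebra.adjoin ℂ
            ({X ^ 2 - C ((q : ℂ) ^ 2),
              (X - C (q : ℂ)) * (X ^ 2 - C ((q : ℂ) ^ 2)) ^ q} : Set (Polynomial ℂ)),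
          f ≠ 0 ∧ f.natDegree = n) ↔ (Even n ∨ 2 * q + 1 ≤ n) := by
    refine ⟨?_, exists_mem_adjoin_natDegree_eq _ _ q⟩
    rintro ⟨f, hf, -, rfl⟩
    exact even_or_le_natDegree_of_mem_adjoin _ q hf
  refine ⟨hdeg, ?_⟩
  rw [← span_X_pow_eq_adjoin]
  congr 1
  ext g
  simp only [Set.mem_ofPred_eq, ← hdeg]
  constructor
  · rintro ⟨f, hf, hf0, rfl⟩
    exact ⟨_, ⟨f, hf, hf0, rfl⟩, rfl⟩
  · rintro ⟨_, ⟨f, hf, hf0, rfl⟩, rfl⟩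
    exact ⟨f, hf, hf0, rfl⟩
end
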